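/- arXiv:2409.13065 — 2 statements merged into one kernel-verified Lean document; each statement's English description precedes it below -/
import Mathlib

section
/- Let X_1, ..., X_n and Y_1, ..., Y_m (n, m ≥ 1) be finitely-valued random variables on a probability space such that, for each i ∈ {1, ..., n}, the variables Y_1, ..., Y_m are mutually conditionally independent given X_i. Then Σ_{i=1}^n I(X_i; (Y_1, ..., Y_m)) ≤ Σ_{j=1}^m Σ_{i=1}^n I(X_i; Y_j). (This is the paper's statement that the multi-agent information-gain reward g(s) = Σ_i I(X_i; Y_{λ_k}) is bounded above by the sum of single-agent heuristic rewards h(s) = Σ_j Σ_i I(X_i; Y_j).) -/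
open MeasureTheory

/-- Shannon entropy of a finitely-valued random variable `X` under measure `μ`. -/
noncomputable def entropy {Ω : Type*} [MeasurableSpace Ω] (μ : Measure Ω)
    {S : Type*} [Fintype S] (X : Ω → S) : ℝ :=
  ∑ x : S, Real.negMulLog (μ (X ⁻¹' {x})).toReal

/-- Mutual information `I(X; Y) = H(X) + H(Y) - H(X, Y)`. -/
noncomputable def mutualInfo {Ω : Type*} [MeasurableSpace Ω] (μ : Measure Ω)
    {S T : Type*} [Fintype S] [Fintype T] (X : Ω → S) (Y : Ω → T) : ℝ :=
  entropy μ X + entropy μ Y - entropy μ (fun ω => (X ω, Y ω))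

/-- Conditional mutual information
`I(X; Y | Z) = H(X,Z) + H(Y,Z) - H(X,Y,Z) - H(Z)`,
i.e. mutual information with all entropies conditioned on `Z`. -/
noncomputable def condMutualInfo {Ω : Type*} [MeasurableSpace Ω] (μ : Measure Ω)
    {S T U : Type*} [Fintype S] [Fintype T] [Fintype U]
    (X : Ω → S) (Y : Ω → T) (Z : Ω → U) : ℝ :=
  entropy μ (fun ω => (X ω, Z ω)) + entropy μ (fun ω => (Y ω, Z ω))
    - entropy μ (fun ω => ((X ω, Y ω), Z ω)) - entropy μ Z

/-- The family `Y_1, …, Y_m` is mutually conditionally independent given `W`: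
conditioned on `W`, the joint distribution factors as the product of the
conditional marginals (stated in division-free form). -/
def CondIndepFamilyGiven {Ω : Type*} [MeasurableSpace Ω] (μ : Measure Ω)
    {m : ℕ} {T : Fin m → Type*} [∀ j, Fintype (T j)]
    (Y : ∀ j, Ω → T j) {V : Type*} (W : Ω → V) : Prop :=
  ∀ (w : V) (y : ∀ j, T j),
    μ ((⋂ j, Y j ⁻¹' {y j}) ∩ W ⁻¹' {w}) * (μ (W ⁻¹' {w})) ^ (m - 1)
      = ∏ j, μ (Y j ⁻¹' {y j} ∩ W ⁻¹' {w})

/-- `Y₁` and `Y₂` are conditionally independent given `W` (division-free form). -/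
def CondIndepPairGiven {Ω : Type*} [MeasurableSpace Ω] (μ : Measure Ω)
    {T₁ T₂ V : Type*} (Y₁ : Ω → T₁) (Y₂ : Ω → T₂) (W : Ω → V) : Prop :=
  ∀ (y₁ : T₁) (y₂ : T₂) (w : V),
    μ (Y₁ ⁻¹' {y₁} ∩ Y₂ ⁻¹' {y₂} ∩ W ⁻¹' {w}) * μ (W ⁻¹' {w})
      = μ (Y₁ ⁻¹' {y₁} ∩ W ⁻¹' {w}) * μ (Y₂ ⁻¹' {y₂} ∩ W ⁻¹' {w})

lemma Real.negMulLog_le_of_eq_zero_imp {p q : ℝ} (hp : 0 ≤ p) (hq : 0 ≤ q)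
    (h : q = 0 → p = 0) : Real.negMulLog p ≤ -(p * Real.log q) + (q - p) := by
  rcases hp.eq_or_lt with rfl | hp
  · simpa using hq
  have hq : 0 < q := hq.lt_of_ne fun h0 => hp.ne' (h h0.symm)
  have key := mul_le_mul_of_nonneg_left (Real.log_le_sub_one_of_pos (div_pos hq hp)) hp.le
  rw [Real.log_div hq.ne' hp.ne', mul_sub, mul_sub, mul_div_cancel₀ _ hp.ne'] at key
  rw [Real.negMulLog]
  linarith

section

variable {Ω : Type*} [MeasurableSpace Ω] {μ : Measure Ω}

lemma entropy_eq_neg_sum {S : Type*} [Fintype S] (X : Ω → S) :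
    entropy μ X = -∑ x, μ.real (X ⁻¹' {x}) * Real.log (μ.real (X ⁻¹' {x})) := by
  simp [entropy, Real.negMulLog, Measure.real]

/-- Change of variables for the expectation of a function of `f ∘ Z`. -/
lemma sum_measureReal_preimage_mul_comp [IsFiniteMeasure μ] {U V : Type*} [Fintype U]
    [Fintype V] [MeasurableSpace U] [MeasurableSingletonClass U] {Z : Ω → U} (hZ : Measurable Z)
    (f : U → V) (g : V → ℝ) :
    ∑ u, μ.real (Z ⁻¹' {u}) * g (f u) = ∑ v, μ.real ((fun ω => f (Z ω)) ⁻¹' {v}) * g v := by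
  classical
  rw [← Finset.sum_fiberwise Finset.univ f]
  refine Finset.sum_congr rfl fun v _ => ?_
  have hpre : (fun ω => f (Z ω)) ⁻¹' {v}
      = ⋃ u ∈ Finset.univ.filter (fun u => f u = v), Z ⁻¹' {u} := by
    ext ω
    simp
  rw [hpre, measureReal_biUnion_finset, Finset.sum_mul]
  · refine Finset.sum_congr rfl fun u hu => ?_
    rw [(Finset.mem_filter.1 hu).2]
  · exact fun a _ b _ hab => (Set.disjoint_singleton.2 hab).preimage Z
  · exact fun u _ => hZ (measurableSet_singleton u)

lemma sum_measureReal_preimage_singleton_eq_one [IsProbabilityMeasure μ] {U : Type*} [Fintype U]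
    [MeasurableSpace U] [MeasurableSingletonClass U] {Z : Ω → U} (hZ : Measurable Z) :
    ∑ u, μ.real (Z ⁻¹' {u}) = 1 := by
  simpa [Set.preimage] using
    sum_measureReal_preimage_mul_comp (μ := μ) hZ (fun _ => ()) (fun _ => (1 : ℝ))

lemma sum_measureReal_preimage_mul_log_comp [IsFiniteMeasure μ] {U V : Type*} [Fintype U]
    [Fintype V] [MeasurableSpace U] [MeasurableSingletonClass U] {Z : Ω → U} (hZ : Measurable Z)
    (f : U → V) :
    ∑ u, μ.real (Z ⁻¹' {u}) * Real.log (μ.real ((fun ω => f (Z ω)) ⁻¹' {f u}))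
      = -entropy μ (fun ω => f (Z ω)) := by
  rw [entropy_eq_neg_sum, neg_neg]
  exact sum_measureReal_preimage_mul_comp hZ f
    fun v => Real.log (μ.real ((fun ω => f (Z ω)) ⁻¹' {v}))

lemma measureReal_preimage_singleton_le_comp [IsFiniteMeasure μ] {U V : Type*} (Z : Ω → U)
    (f : U → V) (u : U) :
    μ.real (Z ⁻¹' {u}) ≤ μ.real ((fun ω => f (Z ω)) ⁻¹' {f u}) :=
  measureReal_mono fun _ hω => congrArg f hω

/-- Subadditivity of entropy. -/
lemma entropy_pi_le_sum [IsProbabilityMeasure μ] {ι : Type*} [Fintype ι] [DecidableEq ι]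
    {T : ι → Type*} [∀ j, Fintype (T j)] [∀ j, MeasurableSpace (T j)]
    [∀ j, MeasurableSingletonClass (T j)] {Y : ∀ j, Ω → T j} (hY : ∀ j, Measurable (Y j)) :
    entropy μ (fun ω j => Y j ω) ≤ ∑ j, entropy μ (Y j) := by
  have hYm : Measurable (fun ω j => Y j ω) := measurable_pi_lambda _ hY
  set p : (∀ j, T j) → ℝ := fun y => μ.real ((fun ω j => Y j ω) ⁻¹' {y})
  set q : ∀ j, T j → ℝ := fun j t => μ.real (Y j ⁻¹' {t})
  have hpq (y : ∀ j, T j) (j : ι) : p y ≤ q j (y j) :=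
    measureReal_preimage_singleton_le_comp (fun ω j => Y j ω) (fun y => y j) y
  have hlog (y : ∀ j, T j) :
      p y * Real.log (∏ j, q j (y j)) = ∑ j, p y * Real.log (q j (y j)) := by
    have hp0 : 0 ≤ p y := measureReal_nonneg
    rcases hp0.eq_or_lt with h0 | hpos
    · simp [← h0]
    · rw [Real.log_prod fun j _ => (hpos.trans_le (hpq y j)).ne', Finset.mul_sum]
  have hprod : ∑ y : ∀ j, T j, ∏ j, q j (y j) = 1 := by
    rw [← Fintype.prod_sum]
    exact Finset.prod_eq_one fun j _ => sum_measureReal_preimage_singleton_eq_one (hY j)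
  calc entropy μ (fun ω j => Y j ω)
      ≤ ∑ y : ∀ j, T j, (-(p y * Real.log (∏ j, q j (y j))) + (∏ j, q j (y j) - p y)) := by
        refine Finset.sum_le_sum fun y _ => Real.negMulLog_le_of_eq_zero_imp measureReal_nonneg
          (Finset.prod_nonneg fun _ _ => measureReal_nonneg) fun h0 => ?_
        obtain ⟨j, -, hj⟩ := Finset.prod_eq_zero_iff.1 h0
        exact le_antisymm ((hpq y j).trans hj.le) measureReal_nonneg
    _ = ∑ j, -∑ y, p y * Real.log (q j (y j)) := by
        rw [Finset.sum_add_distrib, Finset.sum_sub_distrib, hprod,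
          sum_measureReal_preimage_singleton_eq_one hYm, sub_self, add_zero,
          Finset.sum_neg_distrib, Finset.sum_neg_distrib, Finset.sum_congr rfl fun y _ => hlog y,
          Finset.sum_comm]
    _ = ∑ j, entropy μ (Y j) := by
        refine Finset.sum_congr rfl fun j _ => ?_
        rw [neg_eq_iff_eq_neg]
        exact sum_measureReal_preimage_mul_log_comp hYm (fun y => y j)

/-- Chain rule for the joint entropy of a conditionally independent family. -/
lemma CondIndepFamilyGiven.entropy_prodMk_pi [IsFiniteMeasure μ] {V : Type*} [Fintype V]
    [MeasurableSpace V] [MeasurableSingletonClass V] {m : ℕ}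
    {T : Fin m → Type*} [∀ j, Fintype (T j)] [∀ j, MeasurableSpace (T j)]
    [∀ j, MeasurableSingletonClass (T j)] {W : Ω → V} {Y : ∀ j, Ω → T j}
    (h : CondIndepFamilyGiven μ Y W) (hW : Measurable W) (hY : ∀ j, Measurable (Y j)) :
    entropy μ (fun ω => (W ω, fun j => Y j ω))
      = ∑ j, entropy μ (fun ω => (W ω, Y j ω)) - (m - 1 : ℕ) * entropy μ W := by
  set Z : Ω → V × (∀ j, T j) := fun ω => (W ω, fun j => Y j ω) with hZdef
  have hZ : Measurable Z := hW.prodMk (measurable_pi_lambda _ hY)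
  have hfac (u : V × (∀ j, T j)) :
      μ.real (Z ⁻¹' {u}) * μ.real (W ⁻¹' {u.1}) ^ (m - 1)
        = ∏ j, μ.real ((fun ω => (W ω, Y j ω)) ⁻¹' {(u.1, u.2 j)}) := by
    have hZu : Z ⁻¹' {u} = (⋂ j, Y j ⁻¹' {u.2 j}) ∩ W ⁻¹' {u.1} := by
      ext ω
      simp [hZdef, Prod.ext_iff, funext_iff, and_comm]
    have hWYu (j : Fin m) : (fun ω => (W ω, Y j ω)) ⁻¹' {(u.1, u.2 j)}
        = Y j ⁻¹' {u.2 j} ∩ W ⁻¹' {u.1} := by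
      ext ω
      simp [and_comm]
    simp_rw [hZu, hWYu]
    simpa [Measure.real] using congrArg ENNReal.toReal (h u.1 u.2)
  have hlog (u : V × (∀ j, T j)) :
      μ.real (Z ⁻¹' {u}) * Real.log (μ.real (Z ⁻¹' {u}))
        = ∑ j, μ.real (Z ⁻¹' {u})
            * Real.log (μ.real ((fun ω => (W ω, Y j ω)) ⁻¹' {(u.1, u.2 j)}))
          - (m - 1 : ℕ) * (μ.real (Z ⁻¹' {u}) * Real.log (μ.real (W ⁻¹' {u.1}))) := by
    rcases (measureReal_nonneg : 0 ≤ μ.real (Z ⁻¹' {u})).eq_or_lt with h0 | hpos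
    · simp [← h0]
    have hW0 : 0 < μ.real (W ⁻¹' {u.1}) :=
      hpos.trans_le (measureReal_preimage_singleton_le_comp Z Prod.fst u)
    have hWY0 (j : Fin m) : 0 < μ.real ((fun ω => (W ω, Y j ω)) ⁻¹' {(u.1, u.2 j)}) :=
      hpos.trans_le (measureReal_preimage_singleton_le_comp Z (fun u => (u.1, u.2 j)) u)
    have key := congrArg Real.log (hfac u)
    rw [Real.log_mul hpos.ne' (pow_pos hW0 _).ne', Real.log_pow,
      Real.log_prod fun j _ => (hWY0 j).ne'] at key
    rw [← Finset.mul_sum, ← key]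
    ring
  have hsumW := sum_measureReal_preimage_mul_log_comp (μ := μ) hZ Prod.fst
  have hsumWY (j : Fin m) :=
    sum_measureReal_preimage_mul_log_comp (μ := μ) hZ (fun u => (u.1, u.2 j))
  rw [entropy_eq_neg_sum Z]
  simp_rw [hlog]
  rw [Finset.sum_sub_distrib, ← Finset.mul_sum, Finset.sum_comm]
  simp only [hZdef] at hsumW hsumWY ⊢
  rw [hsumW, Finset.sum_congr rfl fun j _ => hsumWY j, Finset.sum_neg_distrib]
  ring

/-- Joint information is at most the sum of the individual informations, for observations that
are conditionally independent given the hidden variable. -/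
lemma CondIndepFamilyGiven.mutualInfo_pi_le_sum [IsProbabilityMeasure μ] {V : Type*} [Fintype V]
    [MeasurableSpace V] [MeasurableSingletonClass V] {m : ℕ} (hm : 1 ≤ m)
    {T : Fin m → Type*} [∀ j, Fintype (T j)] [∀ j, MeasurableSpace (T j)]
    [∀ j, MeasurableSingletonClass (T j)] {W : Ω → V} {Y : ∀ j, Ω → T j}
    (h : CondIndepFamilyGiven μ Y W) (hW : Measurable W) (hY : ∀ j, Measurable (Y j)) :
    mutualInfo μ W (fun ω j => Y j ω) ≤ ∑ j, mutualInfo μ W (Y j) := by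
  have hsub := entropy_pi_le_sum (μ := μ) hY
  simp only [mutualInfo, Finset.sum_sub_distrib, Finset.sum_add_distrib, Finset.sum_const,
    Finset.card_univ, Fintype.card_fin, nsmul_eq_mul]
  rw [h.entropy_prodMk_pi hW hY, Nat.cast_sub hm, Nat.cast_one]
  linarith

end

/-- If for each location `i`, the observations `Y₁, …, Yₘ` are mutually
conditionally independent given the phenomenon variable `Xᵢ`, then the coupled multi-agent
information gain `g = ∑ᵢ I(Xᵢ; (Y₁, …, Yₘ))` is bounded above by the decoupled heuristic
`h = ∑ⱼ ∑ᵢ I(Xᵢ; Yⱼ)`. -/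
theorem sum_mutualInfo_joint_le_sum_sum_of_condIndep
    {Ω : Type*} [MeasurableSpace Ω] (μ : Measure Ω) [IsProbabilityMeasure μ]
    {n : ℕ} (hn : 1 ≤ n)
    {S : Fin n → Type*} [∀ i, Fintype (S i)] [∀ i, MeasurableSpace (S i)]
    [∀ i, MeasurableSingletonClass (S i)]
    {m : ℕ} (hm : 1 ≤ m)
    {T : Fin m → Type*} [∀ j, Fintype (T j)] [∀ j, MeasurableSpace (T j)]
    [∀ j, MeasurableSingletonClass (T j)]
    (X : ∀ i, Ω → S i) (hX : ∀ i, Measurable (X i))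
    (Y : ∀ j, Ω → T j) (hY : ∀ j, Measurable (Y j))
    (hindep : ∀ i, CondIndepFamilyGiven μ Y (X i)) :
    ∑ i, mutualInfo μ (X i) (fun ω j => Y j ω)
      ≤ ∑ j, ∑ i, mutualInfo μ (X i) (Y j) := by
  rw [Finset.sum_comm]
  exact Finset.sum_le_sum fun i _ => (hindep i).mutualInfo_pi_le_sum hm (hX i) hY
end

section
/- Let X and Y_1, ..., Y_m (m ≥ 2) be finitely-valued random variables on a probability space such that Y_1, ..., Y_m are mutually conditionally independent given X. Then for every j ∈ {2, ..., m}, I(X; Y_j | (Y_1, ..., Y_{j-1})) ≤ I(X; Y_j). (This is the paper's term-by-term bound establishing that each summand of the chain-rule expansion of the coupled information gain is dominated by the corresponding single-agent heuristic term h_j.) -/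
open MeasureTheory

open ProbabilityTheory

section Entropy

variable {Ω : Type*} [MeasurableSpace Ω] (μ : Measure Ω)
  {R S T U : Type*} [Fintype R] [MeasurableSpace R] [MeasurableSingletonClass R]

theorem sum_measureReal_preimage_singleton_eq_one_s6 [IsProbabilityMeasure μ] {V : Ω → R}
    (hV : Measurable V) : ∑ v, μ.real (V ⁻¹' {v}) = 1 := by
  rw [sum_measureReal_preimage_singleton _ fun v _ => hV (measurableSet_singleton v)]
  simp

theorem sum_measureReal_preimage_fiber [DecidableEq S] [IsFiniteMeasure μ] {V : Ω → R}
    (hV : Measurable V) (f : R → S) (s : S) :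
    ∑ v with f v = s, μ.real (V ⁻¹' {v}) = μ.real ((fun ω => f (V ω)) ⁻¹' {s}) := by
  rw [sum_measureReal_preimage_singleton _ fun v _ => hV (measurableSet_singleton v)]
  congr 1
  ext ω
  simp

variable [Fintype S]

theorem entropy_comp_eq_neg_sum [IsFiniteMeasure μ] {V : Ω → R}
    (hV : Measurable V) (f : R → S) :
    entropy μ (fun ω => f (V ω)) =
      -∑ v, μ.real (V ⁻¹' {v}) * Real.log (μ.real ((fun ω => f (V ω)) ⁻¹' {f v})) := by
  classical
  rw [entropy, ← Finset.sum_fiberwise Finset.univ f, ← Finset.sum_neg_distrib]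
  refine Finset.sum_congr rfl fun s _ => ?_
  rw [← measureReal_def, Real.negMulLog]
  nth_rw 1 [← sum_measureReal_preimage_fiber μ hV f s]
  rw [← Finset.sum_neg_distrib, Finset.sum_mul, ← Finset.sum_neg_distrib]
  refine Finset.sum_congr rfl fun v hv => ?_
  rw [(Finset.mem_filter.mp hv).2, neg_mul]

variable [MeasurableSpace S] [MeasurableSingletonClass S]
  [Fintype T] [MeasurableSpace T] [MeasurableSingletonClass T]
  [Fintype U] [MeasurableSpace U] [MeasurableSingletonClass U]

theorem entropy_prodMk_le_add [IsProbabilityMeasure μ] {Y : Ω → T} {Z : Ω → U}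
    (hY : Measurable Y) (hZ : Measurable Z) :
    entropy μ (fun ω => (Y ω, Z ω)) ≤ entropy μ Y + entropy μ Z := by
  have hV : Measurable fun ω => (Y ω, Z ω) := hY.prodMk hZ
  have hYZ := entropy_comp_eq_neg_sum μ hV id
  have hY' := entropy_comp_eq_neg_sum μ hV Prod.fst
  have hZ' := entropy_comp_eq_neg_sum μ hV Prod.snd
  simp only [id] at hYZ hY' hZ'
  have hone : ∑ v : T × U, μ.real (Y ⁻¹' {v.1}) * μ.real (Z ⁻¹' {v.2}) = 1 := by
    rw [Fintype.sum_prod_type' fun y z => μ.real (Y ⁻¹' {y}) * μ.real (Z ⁻¹' {z}),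
      ← Fintype.sum_mul_sum,
      sum_measureReal_preimage_singleton_eq_one_s6 μ hY,
      sum_measureReal_preimage_singleton_eq_one_s6 μ hZ, mul_one]
  have key : ∑ v : T × U, (μ.real ((fun ω => (Y ω, Z ω)) ⁻¹' {v})
        - μ.real (Y ⁻¹' {v.1}) * μ.real (Z ⁻¹' {v.2})) ≤
      ∑ v : T × U, (μ.real ((fun ω => (Y ω, Z ω)) ⁻¹' {v}) *
          Real.log (μ.real ((fun ω => (Y ω, Z ω)) ⁻¹' {v}))
        - μ.real ((fun ω => (Y ω, Z ω)) ⁻¹' {v}) * Real.log (μ.real (Y ⁻¹' {v.1}))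
        - μ.real ((fun ω => (Y ω, Z ω)) ⁻¹' {v}) * Real.log (μ.real (Z ⁻¹' {v.2}))) := by
    refine Finset.sum_le_sum fun v _ => ?_
    have hpa : μ.real ((fun ω => (Y ω, Z ω)) ⁻¹' {v}) ≤ μ.real (Y ⁻¹' {v.1}) :=
      measureReal_mono fun ω h => congrArg Prod.fst h
    have hpb : μ.real ((fun ω => (Y ω, Z ω)) ⁻¹' {v}) ≤ μ.real (Z ⁻¹' {v.2}) :=
      measureReal_mono fun ω h => congrArg Prod.snd h
    have hp : 0 ≤ μ.real ((fun ω => (Y ω, Z ω)) ⁻¹' {v}) := measureReal_nonneg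
    generalize μ.real ((fun ω => (Y ω, Z ω)) ⁻¹' {v}) = p at *
    generalize μ.real (Y ⁻¹' {v.1}) = a at *
    generalize μ.real (Z ⁻¹' {v.2}) = b at *
    rcases hp.eq_or_lt with rfl | hp
    · simpa using mul_nonneg hpa hpb
    have ha := hp.trans_le hpa
    have hb := hp.trans_le hpb
    have h := Real.log_le_sub_one_of_pos (show 0 < a * b / p by positivity)
    rw [Real.log_div (by positivity) hp.ne', Real.log_mul ha.ne' hb.ne'] at h
    have h' := mul_le_mul_of_nonneg_left h hp.le
    have h'' : p * (a * b / p - 1) = a * b - p := by field_simp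
    linarith
  simp only [Finset.sum_sub_distrib] at key
  rw [sum_measureReal_preimage_singleton_eq_one_s6 μ hV, hone] at key
  linarith

theorem CondIndepPairGiven.entropy_add_entropy [IsFiniteMeasure μ]
    {X : Ω → S} {Y : Ω → T} {Z : Ω → U}
    (hX : Measurable X) (hY : Measurable Y) (hZ : Measurable Z)
    (h : CondIndepPairGiven μ Y Z X) :
    entropy μ (fun ω => ((X ω, Y ω), Z ω)) + entropy μ X =
      entropy μ (fun ω => (X ω, Y ω)) + entropy μ (fun ω => (X ω, Z ω)) := by
  have hV : Measurable fun ω => ((X ω, Y ω), Z ω) := (hX.prodMk hY).prodMk hZ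
  have hXYZ := entropy_comp_eq_neg_sum μ hV id
  have hX' := entropy_comp_eq_neg_sum μ hV fun v => v.1.1
  have hXY := entropy_comp_eq_neg_sum μ hV fun v => v.1
  have hXZ := entropy_comp_eq_neg_sum μ hV fun v => (v.1.1, v.2)
  simp only [id] at hXYZ hX' hXY hXZ
  rw [hXYZ, hX', hXY, hXZ, ← neg_add, ← neg_add, ← Finset.sum_add_distrib,
    ← Finset.sum_add_distrib]
  congr 1
  refine Finset.sum_congr rfl fun ⟨⟨x, y⟩, z⟩ _ => ?_
  have hpx : μ.real ((fun ω => ((X ω, Y ω), Z ω)) ⁻¹' {((x, y), z)}) ≤ μ.real (X ⁻¹' {x}) :=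
    measureReal_mono fun ω h => congrArg (fun v : (S × T) × U => v.1.1) h
  have hpxy : μ.real ((fun ω => ((X ω, Y ω), Z ω)) ⁻¹' {((x, y), z)}) ≤
      μ.real ((fun ω => (X ω, Y ω)) ⁻¹' {(x, y)}) :=
    measureReal_mono fun ω h => congrArg (fun v : (S × T) × U => v.1) h
  have hpxz : μ.real ((fun ω => ((X ω, Y ω), Z ω)) ⁻¹' {((x, y), z)}) ≤
      μ.real ((fun ω => (X ω, Z ω)) ⁻¹' {(x, z)}) :=
    measureReal_mono fun ω h => congrArg (fun v : (S × T) × U => (v.1.1, v.2)) h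
  have hfac : μ.real ((fun ω => ((X ω, Y ω), Z ω)) ⁻¹' {((x, y), z)}) * μ.real (X ⁻¹' {x}) =
      μ.real ((fun ω => (X ω, Y ω)) ⁻¹' {(x, y)}) *
        μ.real ((fun ω => (X ω, Z ω)) ⁻¹' {(x, z)}) := by
    simp only [measureReal_def, ← ENNReal.toReal_mul]
    convert congrArg ENNReal.toReal (h y z x) using 4 <;> ext ω <;> simp <;> tauto
  rcases (measureReal_nonneg (μ := μ)
    (s := (fun ω => ((X ω, Y ω), Z ω)) ⁻¹' {((x, y), z)})).eq_or_lt with hp | hp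
  · simp [← hp]
  · have hlog := congrArg Real.log hfac
    rw [Real.log_mul hp.ne' (hp.trans_le hpx).ne',
      Real.log_mul (hp.trans_le hpxy).ne' (hp.trans_le hpxz).ne'] at hlog
    rw [← mul_add, ← mul_add, hlog]

theorem CondIndepPairGiven.condMutualInfo_le_mutualInfo [IsProbabilityMeasure μ]
    {X : Ω → S} {Y : Ω → T} {Z : Ω → U}
    (hX : Measurable X) (hY : Measurable Y) (hZ : Measurable Z)
    (h : CondIndepPairGiven μ Y Z X) :
    condMutualInfo μ X Y Z ≤ mutualInfo μ X Y := by
  have h₁ := h.entropy_add_entropy μ hX hY hZ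
  have h₂ := entropy_prodMk_le_add μ hY hZ
  rw [condMutualInfo, mutualInfo]
  linarith

end Entropy

section CondIndep

variable {Ω : Type*} [MeasurableSpace Ω] (μ : Measure Ω) [IsFiniteMeasure μ]
  {S : Type*} [MeasurableSpace S] [MeasurableSingletonClass S]
  {m : ℕ} {T : Fin m → Type*} [∀ j, Fintype (T j)] [∀ j, MeasurableSpace (T j)]
  [∀ j, MeasurableSingletonClass (T j)]

theorem CondIndepFamilyGiven.iIndepFun_cond {X : Ω → S} (hX : Measurable X)
    {Y : ∀ j, Ω → T j} (hY : ∀ j, Measurable (Y j)) (hm : m ≠ 0)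
    (h : CondIndepFamilyGiven μ Y X) {x : S} (hx : μ (X ⁻¹' {x}) ≠ 0) :
    iIndepFun Y μ[|X ⁻¹' {x}] := by
  have hmeas : MeasurableSet (X ⁻¹' {x}) := hX (measurableSet_singleton x)
  have := cond_isProbabilityMeasure hx
  rw [iIndepFun_iff_map_fun_eq_pi_map fun j => (hY j).aemeasurable]
  refine Measure.ext_of_singleton fun y => ?_
  rw [Measure.map_apply (measurable_pi_lambda _ hY) (measurableSet_singleton y),
    Measure.pi_singleton]
  simp_rw [Measure.map_apply (hY _) (measurableSet_singleton _), cond_apply hmeas]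
  have hpre : (fun ω j => Y j ω) ⁻¹' {y} = ⋂ j, Y j ⁻¹' {y j} := by
    ext ω
    simp [funext_iff]
  rw [hpre, Finset.prod_mul_distrib, Finset.prod_const, Finset.card_univ, Fintype.card_fin]
  have hxy := h x y
  simp_rw [Set.inter_comm (X ⁻¹' {x})]
  rw [← hxy]
  obtain ⟨n, rfl⟩ := Nat.exists_eq_succ_of_ne_zero hm
  have hc : (μ (X ⁻¹' {x}))⁻¹ ^ n * μ (X ⁻¹' {x}) ^ n = 1 := by
    rw [← mul_pow, ENNReal.inv_mul_cancel hx (measure_ne_top _ _), one_pow]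
  rw [Nat.succ_sub_one, pow_succ]
  calc _ = (μ (X ⁻¹' {x}))⁻¹ * μ ((⋂ j, Y j ⁻¹' {y j}) ∩ X ⁻¹' {x}) * 1 := by rw [mul_one]
    _ = _ := by rw [← hc]; ring

theorem condIndepPairGiven_of_indepFun_cond {T U : Type*}
    [MeasurableSpace T] [MeasurableSingletonClass T]
    [MeasurableSpace U] [MeasurableSingletonClass U]
    {X : Ω → S} (hX : Measurable X) {Y : Ω → T} {Z : Ω → U}
    (h : ∀ x, μ (X ⁻¹' {x}) ≠ 0 → IndepFun Y Z μ[|X ⁻¹' {x}]) :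
    CondIndepPairGiven μ Y Z X := by
  intro y z x
  by_cases hx : μ (X ⁻¹' {x}) = 0
  · rw [hx, measure_inter_null_of_null_right _ hx, measure_inter_null_of_null_right _ hx]
    simp
  have hyz := (h x hx).measure_inter_preimage_eq_mul {y} {z} (measurableSet_singleton y)
    (measurableSet_singleton z)
  have hcond := fun t => cond_mul_eq_inter (hX (measurableSet_singleton x)) t μ
  simp_rw [Set.inter_comm _ (X ⁻¹' {x}), ← hcond, hyz]
  ring

end CondIndep

/-- If `Y₁, …, Yₘ` (m ≥ 2, here `Y 0 = Y₁, …, Y (m-1) = Yₘ`) are mutually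
conditionally independent given `X`, then for every `j ∈ {2, …, m}`,
`I(X; Yⱼ | (Y₁, …, Y_{j-1})) ≤ I(X; Yⱼ)`. -/
theorem condMutualInfo_prefix_le_mutualInfo_of_condIndep
    {Ω : Type*} [MeasurableSpace Ω] (μ : Measure Ω) [IsProbabilityMeasure μ]
    {S : Type*} [Fintype S] [MeasurableSpace S] [MeasurableSingletonClass S]
    {m : ℕ} (hm : 2 ≤ m)
    {T : Fin m → Type*} [∀ j, Fintype (T j)] [∀ j, MeasurableSpace (T j)]
    [∀ j, MeasurableSingletonClass (T j)]
    (X : Ω → S) (hX : Measurable X)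
    (Y : ∀ j, Ω → T j) (hY : ∀ j, Measurable (Y j))
    (hindep : CondIndepFamilyGiven μ Y X)
    (j : ℕ) (hj2 : 2 ≤ j) (hjm : j ≤ m) :
    condMutualInfo μ X (Y ⟨j - 1, by omega⟩)
        (fun ω (k : Fin (j - 1)) => Y (Fin.castLE (by omega) k) ω)
      ≤ mutualInfo μ X (Y ⟨j - 1, by omega⟩) := by
  have hZ : Measurable fun ω (k : Fin (j - 1)) => Y (Fin.castLE (by omega) k) ω :=
    measurable_pi_lambda _ fun k => hY _
  refine CondIndepPairGiven.condMutualInfo_le_mutualInfo μ hX (hY _) hZ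
    (condIndepPairGiven_of_indepFun_cond μ hX fun x hx => ?_)
  have hind := (hindep.iIndepFun_cond μ hX hY (by omega) hx).indepFun_finset
    {⟨j - 1, by omega⟩} (Finset.univ.filter fun k : Fin m => (k : ℕ) < j - 1)
    (by simp) hY
  refine hind.comp
    (φ := fun g => g ⟨⟨j - 1, by omega⟩, Finset.mem_singleton_self _⟩)
    (ψ := fun g (k : Fin (j - 1)) => g ⟨Fin.castLE (by omega) k, by simp⟩) ?_ ?_
  · exact measurable_pi_apply _
  · exact measurable_pi_lambda _ fun k => measurable_pi_apply _
end
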